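/- arXiv:2111.12600 — 2 statements merged into one kernel-verified Lean document; each statement's English description precedes it below -/
import Mathlib

section
/- Value-function transfer bound between an MDP and its latent (DeepMDP) model: let S be a measurable space, let Z be a metric space equipped with its Borel σ-algebra, let A be a measurable space, and let γ ∈ [0,1). Let P be a Markov kernel from S × A to S and P̄ a Markov kernel from Z × A to Z; let R : S × A → ℝ and R̄ : Z × A → ℝ be bounded measurable reward functions; let φ : S → Z be a measurable embedding map; and let π̄ be a Markov kernel from Z to A (a latent policy). Let Q : S × A → ℝ and Q̄ : Z × A → ℝ be bounded measurable functions satisfying the Bellman equations Q(s,a) = R(s,a) + γ ∫_S ∫_A Q(s',a') π̄(da'|φ(s')) P(ds'|s,a) and Q̄(z,a) = R̄(z,a) + γ ∫_Z ∫_A Q̄(z',a') π̄(da'|z') P̄(dz'|z,a), and define V̄(z) = ∫_A Q̄(z,a) π̄(da|z). Suppose: (i) V̄ is Lipschitz with constant K_V̄ ≥ 0; (ii) there is a constant L_R ≥ 0 with |R(s,a) − R̄(φ(s),a)| ≤ L_R for all s ∈ S, a ∈ A; (iii) there is a constant L_P ≥ 0 such that for every 1-Lipschitz function f : Z → ℝ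 and all s ∈ S, a ∈ A one has |∫_S f(φ(s')) P(ds'|s,a) − ∫_Z f(z') P̄(dz'|φ(s),a)| ≤ L_P (the Kantorovich-dual form of the condition that the 1-Wasserstein distance between the pushforward φ_*P(·|s,a) and P̄(·|φ(s),a) is at most L_P). Then for all s ∈ S and a ∈ A, |Q(s,a) − Q̄(φ(s),a)| ≤ (L_R + γ K_V̄ L_P)/(1 − γ). -/
open MeasureTheory ProbabilityTheory

/-- Integrals against a probability measure of two integrable functions at uniform
distance at most `M` differ by at most `M`. -/
lemma abs_integral_sub_integral_le_of_abs_sub_le {X : Type*} [MeasurableSpace X] {μ : Measure X}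
    [IsProbabilityMeasure μ] {f g : X → ℝ} {M : ℝ} (hf : Integrable f μ) (hg : Integrable g μ)
    (h : ∀ x, |f x - g x| ≤ M) : |(∫ x, f x ∂μ) - ∫ x, g x ∂μ| ≤ M := by
  rw [← integral_sub hf hg]
  simpa using norm_integral_le_of_norm_le_const (μ := μ) (f := fun x => f x - g x)
    (Filter.Eventually.of_forall h)

lemma integrable_of_abs_le {X : Type*} [MeasurableSpace X] {μ : Measure X} [IsFiniteMeasure μ]
    {f : X → ℝ} {C : ℝ} (hf : Measurable f) (h : ∀ x, |f x| ≤ C) : Integrable f μ :=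
  Integrable.of_bound hf.aestronglyMeasurable C (Filter.Eventually.of_forall h)

lemma abs_integral_le_of_abs_le {X : Type*} [MeasurableSpace X] {μ : Measure X}
    [IsProbabilityMeasure μ] {f : X → ℝ} {C : ℝ} (h : ∀ x, |f x| ≤ C) : |∫ x, f x ∂μ| ≤ C := by
  simpa using norm_integral_le_of_norm_le_const (μ := μ) (f := f)
    (Filter.Eventually.of_forall h)

/-- A Kantorovich-dual bound on `1`-Lipschitz functions scales to `K`-Lipschitz functions. -/
lemma abs_integral_comp_sub_integral_le_of_lipschitzWith {X Z : Type*} [MeasurableSpace X]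
    [MetricSpace Z] [MeasurableSpace Z] {μ : Measure X} [IsProbabilityMeasure μ]
    {ν : Measure Z} [IsProbabilityMeasure ν] {φ : X → Z} {L : ℝ}
    (h : ∀ f : Z → ℝ, LipschitzWith 1 f → |(∫ x, f (φ x) ∂μ) - ∫ z, f z ∂ν| ≤ L)
    {K : ℝ} (hK : 0 ≤ K) {g : Z → ℝ} (hg : LipschitzWith K.toNNReal g) :
    |(∫ x, g (φ x) ∂μ) - ∫ z, g z ∂ν| ≤ K * L := by
  have hdist (x y : Z) : |g x - g y| ≤ K * dist x y := by
    simpa [Real.dist_eq, Real.coe_toNNReal K hK] using hg.dist_le_mul x y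
  rcases hK.eq_or_lt with rfl | hpos
  · obtain ⟨z₀⟩ : Nonempty Z := ν.nonempty_of_neZero
    have hconst : g = fun _ => g z₀ := by
      ext z
      have := hdist z z₀
      rw [zero_mul] at this
      exact sub_eq_zero.1 (abs_nonpos_iff.1 this)
    rw [hconst]
    simp
  · have hlip : LipschitzWith 1 fun z => K⁻¹ * g z := by
      refine LipschitzWith.of_dist_le_mul fun x y => ?_
      rw [Real.dist_eq, ← mul_sub, abs_mul, abs_of_pos (inv_pos.2 hpos), NNReal.coe_one, one_mul,
        inv_mul_le_iff₀ hpos]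
      exact hdist x y
    have := h _ hlip
    rwa [integral_const_mul, integral_const_mul, ← mul_sub, abs_mul,
      abs_of_pos (inv_pos.2 hpos), inv_mul_le_iff₀ hpos] at this

/-- Value-function transfer bound between an MDP and its latent (DeepMDP) model:
`|Q(s,a) − Q̄(φ(s),a)| ≤ (L_R + γ K_V̄ L_P)/(1 − γ)`. -/
theorem deepmdp_value_transfer_bound
    {S Z A : Type*} [MeasurableSpace S]
    [MetricSpace Z] [MeasurableSpace Z] [BorelSpace Z] [MeasurableSpace A]
    (γ : ℝ) (hγ0 : 0 ≤ γ) (hγ1 : γ < 1)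
    (P : Kernel (S × A) S) [IsMarkovKernel P]
    (Pbar : Kernel (Z × A) Z) [IsMarkovKernel Pbar]
    (R : S × A → ℝ) (hRmeas : Measurable R) (hRbdd : ∃ C : ℝ, ∀ x, |R x| ≤ C)
    (Rbar : Z × A → ℝ) (hRbarMeas : Measurable Rbar)
    (hRbarBdd : ∃ C : ℝ, ∀ x, |Rbar x| ≤ C)
    (φ : S → Z) (hφ : Measurable φ)
    (πbar : Kernel Z A) [IsMarkovKernel πbar]
    (Q : S × A → ℝ) (hQmeas : Measurable Q) (hQbdd : ∃ C : ℝ, ∀ x, |Q x| ≤ C)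
    (Qbar : Z × A → ℝ) (hQbarMeas : Measurable Qbar)
    (hQbarBdd : ∃ C : ℝ, ∀ x, |Qbar x| ≤ C)
    (hQbell : ∀ s a, Q (s, a) =
      R (s, a) + γ * ∫ s', ∫ a', Q (s', a') ∂(πbar (φ s')) ∂(P (s, a)))
    (hQbarBell : ∀ z a, Qbar (z, a) =
      Rbar (z, a) + γ * ∫ z', ∫ a', Qbar (z', a') ∂(πbar z') ∂(Pbar (z, a)))
    (Vbar : Z → ℝ) (hVbar : ∀ z, Vbar z = ∫ a, Qbar (z, a) ∂(πbar z))
    (KV : ℝ) (hKV0 : 0 ≤ KV) (hVbarLip : LipschitzWith KV.toNNReal Vbar)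
    (LR : ℝ) (hLR0 : 0 ≤ LR) (hLR : ∀ s a, |R (s, a) - Rbar (φ s, a)| ≤ LR)
    (LP : ℝ) (hLP0 : 0 ≤ LP)
    (hLP : ∀ f : Z → ℝ, LipschitzWith 1 f → ∀ s a,
      |(∫ s', f (φ s') ∂(P (s, a))) - ∫ z', f z' ∂(Pbar (φ s, a))| ≤ LP) :
    ∀ s a, |Q (s, a) - Qbar (φ s, a)| ≤ (LR + γ * KV * LP) / (1 - γ) := by
  obtain ⟨C, hC⟩ := hQbdd
  obtain ⟨D, hD⟩ := hQbarBdd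
  have hWmeas : Measurable fun s => ∫ a, Q (s, a) ∂(πbar (φ s)) :=
    (hQmeas.stronglyMeasurable.integral_kernel_prod_right'
      (κ := πbar.comap φ hφ)).measurable
  have hVmeas : Measurable Vbar := by
    rw [funext hVbar]
    exact (hQbarMeas.stronglyMeasurable.integral_kernel_prod_right' (κ := πbar)).measurable
  have hVbdd (z : Z) : |Vbar z| ≤ D := by
    rw [hVbar]
    exact abs_integral_le_of_abs_le fun a => hD (z, a)
  have hcontract (M : ℝ) (hM : ∀ s a, |Q (s, a) - Qbar (φ s, a)| ≤ M) (s : S) (a : A) :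
      |Q (s, a) - Qbar (φ s, a)| ≤ LR + γ * (M + KV * LP) := by
    have hpolicy (s' : S) : |(∫ a', Q (s', a') ∂(πbar (φ s'))) - Vbar (φ s')| ≤ M := by
      rw [hVbar]
      exact abs_integral_sub_integral_le_of_abs_sub_le
        (integrable_of_abs_le (hQmeas.comp measurable_prodMk_left) fun a' => hC (s', a'))
        (integrable_of_abs_le (hQbarMeas.comp measurable_prodMk_left) fun a' => hD (φ s', a'))
        (hM s')
    have hstep : |(∫ s', ∫ a', Q (s', a') ∂(πbar (φ s')) ∂(P (s, a))) -
        ∫ s', Vbar (φ s') ∂(P (s, a))| ≤ M :=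
      abs_integral_sub_integral_le_of_abs_sub_le
        (integrable_of_abs_le hWmeas fun s' => abs_integral_le_of_abs_le fun a' => hC (s', a'))
        (integrable_of_abs_le (hVmeas.comp hφ) fun s' => hVbdd (φ s')) hpolicy
    have hmodel := abs_integral_comp_sub_integral_le_of_lipschitzWith
      (fun f hf => hLP f hf s a) hKV0 hVbarLip
    have hnext := (abs_sub_le _ _ _).trans (add_le_add hstep hmodel)
    rw [hQbell, hQbarBell]
    simp only [← hVbar]
    rw [add_sub_add_comm, ← mul_sub]
    refine (abs_add_le _ _).trans (add_le_add (hLR s a) ?_)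
    rw [abs_mul, abs_of_nonneg hγ0]
    exact mul_le_mul_of_nonneg_left hnext hγ0
  intro s a
  have : Nonempty (S × A) := ⟨(s, a)⟩
  let gap : S × A → ℝ := fun x => |Q x - Qbar (φ x.1, x.2)|
  have hgap : BddAbove (Set.range gap) := by
    refine ⟨C + D, ?_⟩
    rintro _ ⟨x, rfl⟩
    exact (abs_sub _ _).trans (add_le_add (hC x) (hD _))
  have hle (s : S) (a : A) : |Q (s, a) - Qbar (φ s, a)| ≤ ⨆ x, gap x := le_ciSup hgap (s, a)
  have hsup : ⨆ x, gap x ≤ LR + γ * ((⨆ x, gap x) + KV * LP) :=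
    ciSup_le fun x => hcontract _ hle x.1 x.2
  refine (hle s a).trans ?_
  rw [le_div_iff₀ (sub_pos.2 hγ1)]
  linarith
end

section
/- Lipschitz continuity of the latent value function: let Z be a metric space with metric d_Z equipped with its Borel σ-algebra, let A be a measurable space, and let γ ∈ [0,1). Let P̄ be a Markov kernel from Z × A to Z, let R̄ : Z × A → ℝ be a bounded measurable reward, and let π̄ be a Markov kernel from Z to A. Let Q̄ : Z × A → ℝ be a bounded measurable function satisfying the Bellman equation Q̄(z,a) = R̄(z,a) + γ ∫_Z ∫_A Q̄(z',a') π̄(da'|z') P̄(dz'|z,a), and define V̄(z) = ∫_A Q̄(z,a) π̄(da|z). Suppose there are constants L_R̄ ≥ 0 and L_P̄ ≥ 0 with γ · L_P̄ < 1 such that: (i) for all z₁, z₂ ∈ Z, |V̄(z₁) − R̄-part comparison holds in the averaged sense: |∫_A R̄(z₁,a) π̄(da|z₁) − ∫_A R̄(z₂,a) π̄(da|z₂)| ≤ L_R̄ · d_Z(z₁,z₂); and (ii) for every c ≥ 0 and every c-Lipschitz function f : Z → ℝ and all z₁, z₂ ∈ Z, |∫_Z ∫_A f(z') P̄(dz'|z₁,a)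 π̄(da|z₁) − ∫_Z ∫_A f(z') P̄(dz'|z₂,a) π̄(da|z₂)| ≤ c · L_P̄ · d_Z(z₁,z₂) (the Kantorovich-dual form of L_P̄-Lipschitz continuity of the policy-averaged transition kernel in 1-Wasserstein distance). If V̄ is Lipschitz with some finite constant, then V̄ is Lipschitz with constant K_V̄ = L_R̄ / (1 − γ L_P̄); that is, for all z₁, z₂ ∈ Z, |V̄(z₁) − V̄(z₂)| ≤ (L_R̄ / (1 − γ L_P̄)) · d_Z(z₁,z₂). -/
open MeasureTheory ProbabilityTheory

/-- A bound `d ≤ (L + q ^ n * K) * t` for all `n`, with `0 ≤ q < 1`, passes to the limit. -/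
lemma le_mul_of_forall_le_add_pow_mul {q : ℝ} (hq0 : 0 ≤ q) (hq1 : q < 1) {d L K t : ℝ}
    (h : ∀ n : ℕ, d ≤ (L + q ^ n * K) * t) : d ≤ L * t := by
  have hlim : Filter.Tendsto (fun n : ℕ => (L + q ^ n * K) * t) Filter.atTop
      (nhds ((L + 0 * K) * t)) :=
    (((tendsto_pow_atTop_nhds_zero_of_lt_one hq0 hq1).mul_const K).const_add L).mul_const t
  simpa using ge_of_tendsto' hlim h

/-- A bounded measurable function on a product is integrable in its second variable. -/
lemma integrable_section_of_bounded {Z A : Type*} [MeasurableSpace Z] [MeasurableSpace A]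
    {f : Z × A → ℝ} (hf : Measurable f) (hbdd : ∃ C : ℝ, ∀ x, |f x| ≤ C)
    (μ : Measure A) [IsFiniteMeasure μ] (z : Z) : Integrable (fun a => f (z, a)) μ := by
  obtain ⟨C, hC⟩ := hbdd
  exact Integrable.of_bound (hf.comp measurable_prodMk_left).aestronglyMeasurable C
    (Filter.Eventually.of_forall fun a => hC (z, a))

/-- Lipschitz continuity of the latent value function: under Lipschitz continuity of the
policy-averaged reward (constant `L_R̄`) and of the policy-averaged transition kernel in
1-Wasserstein distance (constant `L_P̄`, Kantorovich-dual form), with `γ L_P̄ < 1`, any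
Lipschitz latent value function `V̄` is in fact `L_R̄ / (1 − γ L_P̄)`-Lipschitz. -/
theorem latent_value_function_lipschitz
    {Z A : Type*} [MetricSpace Z] [MeasurableSpace Z] [BorelSpace Z] [MeasurableSpace A]
    (γ : ℝ) (hγ0 : 0 ≤ γ) (hγ1 : γ < 1)
    (Pbar : Kernel (Z × A) Z) [IsMarkovKernel Pbar]
    (Rbar : Z × A → ℝ) (hRbarMeas : Measurable Rbar)
    (hRbarBdd : ∃ C : ℝ, ∀ x, |Rbar x| ≤ C)
    (πbar : Kernel Z A) [IsMarkovKernel πbar]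
    (Qbar : Z × A → ℝ) (hQbarMeas : Measurable Qbar)
    (hQbarBdd : ∃ C : ℝ, ∀ x, |Qbar x| ≤ C)
    (hQbarBell : ∀ z a, Qbar (z, a) =
      Rbar (z, a) + γ * ∫ z', ∫ a', Qbar (z', a') ∂(πbar z') ∂(Pbar (z, a)))
    (Vbar : Z → ℝ) (hVbar : ∀ z, Vbar z = ∫ a, Qbar (z, a) ∂(πbar z))
    (LR : ℝ) (hLR0 : 0 ≤ LR)
    (hLR : ∀ z₁ z₂ : Z,
      |(∫ a, Rbar (z₁, a) ∂(πbar z₁)) - ∫ a, Rbar (z₂, a) ∂(πbar z₂)| ≤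
        LR * dist z₁ z₂)
    (LP : ℝ) (hLP0 : 0 ≤ LP) (hγLP : γ * LP < 1)
    (hLP : ∀ c : ℝ, 0 ≤ c → ∀ f : Z → ℝ, LipschitzWith c.toNNReal f → ∀ z₁ z₂ : Z,
      |(∫ a, ∫ z', f z' ∂(Pbar (z₁, a)) ∂(πbar z₁)) -
        ∫ a, ∫ z', f z' ∂(Pbar (z₂, a)) ∂(πbar z₂)| ≤ c * LP * dist z₁ z₂)
    (hVbarLip : ∃ K : NNReal, LipschitzWith K Vbar) :
    ∀ z₁ z₂ : Z, |Vbar z₁ - Vbar z₂| ≤ (LR / (1 - γ * LP)) * dist z₁ z₂ := by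
  have bellman : ∀ z, Vbar z = (∫ a, Rbar (z, a) ∂(πbar z)) +
      γ * ∫ a, ∫ z', Vbar z' ∂(Pbar (z, a)) ∂(πbar z) := by
    intro z
    have hQR : ∀ a, γ * ∫ z', Vbar z' ∂(Pbar (z, a)) = Qbar (z, a) - Rbar (z, a) := by
      intro a
      simp only [hVbar]
      rw [hQbarBell z a]
      ring
    rw [← integral_const_mul]
    simp only [hQR]
    rw [integral_sub (integrable_section_of_bounded hQbarMeas hQbarBdd _ z)
      (integrable_section_of_bounded hRbarMeas hRbarBdd _ z), ← hVbar z]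
    ring
  obtain ⟨K, hK⟩ := hVbarLip
  have hpos : 0 < 1 - γ * LP := by linarith
  have hq0 : 0 ≤ γ * LP := mul_nonneg hγ0 hLP0
  have hL0 : 0 ≤ LR / (1 - γ * LP) := div_nonneg hLR0 hpos.le
  have hfix : LR + γ * LP * (LR / (1 - γ * LP)) = LR / (1 - γ * LP) := by
    field_simp
    ring
  set L := LR / (1 - γ * LP)
  have iterate : ∀ n : ℕ, ∀ z₁ z₂ : Z,
      |Vbar z₁ - Vbar z₂| ≤ (L + (γ * LP) ^ n * K) * dist z₁ z₂ := by
    intro n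
    induction n with
    | zero =>
      intro z₁ z₂
      have h := hK.dist_le_mul z₁ z₂
      rw [Real.dist_eq] at h
      have := mul_nonneg hL0 (dist_nonneg (x := z₁) (y := z₂))
      rw [pow_zero, one_mul, add_mul]
      linarith
    | succ n ih =>
      intro z₁ z₂
      have hc : 0 ≤ L + (γ * LP) ^ n * K := by positivity
      have hlip : LipschitzWith (L + (γ * LP) ^ n * K).toNNReal Vbar :=
        LipschitzWith.of_dist_le_mul fun x y => by
          rw [Real.dist_eq, Real.coe_toNNReal _ hc]
          exact ih x y
      have hP := hLP _ hc Vbar hlip z₁ z₂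
      have hR := hLR z₁ z₂
      rw [bellman z₁, bellman z₂, add_sub_add_comm, ← mul_sub]
      refine (abs_add_le _ _).trans ?_
      rw [abs_mul, abs_of_nonneg hγ0]
      refine (add_le_add hR (mul_le_mul_of_nonneg_left hP hγ0)).trans_eq ?_
      rw [pow_succ]
      linear_combination dist z₁ z₂ * hfix
  exact fun z₁ z₂ => le_mul_of_forall_le_add_pow_mul hq0 hγLP fun n => iterate n z₁ z₂
end
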